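/- Let $F$ be a complete discretely valued field of characteristic zero with valuation ring $O_F$, uniformizer $\pi$, and residue field $k$. Let $\Gamma$ be a compact subgroup of $\mathrm{GL}(V)$, $V$ a finite-dimensional $F$-vector space, and let $W, W'$ be $\Gamma$-subrepresentations of $V$ with $\Gamma$-stable lattices $\Lambda \subset W$, $\Lambda' \subset W'$. Then $\dim_F \mathrm{Hom}_\Gamma(W, W') \leq \dim_k \mathrm{Hom}_\Gamma(\Lambda \otimes_{O_F} k, \Lambda' \otimes_{O_F} k)$. -/

import Mathlib

open Valued IsLocalRing

noncomputable section

/-- `ℤₘ₀ = WithZero (Multiplicative ℤ)`, the value group of a discrete valuation. -/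
abbrev Zm0 := WithZero (Multiplicative ℤ)

variable {F : Type} [Field F] [Valued F Zm0] {m : ℕ}

/-- The valuation ring `O_F` of a (discretely) valued field `F`. -/
def OF (F : Type) [Field F] [Valued F Zm0] : ValuationSubring F :=
  (Valued.v).valuationSubring

/-- The matrix `g` stabilizes the `O_F`-submodule `Λ` of `F^m`. -/
def MStab (Λ : Submodule ↥(OF F) (Fin m → F)) (g : Matrix (Fin m) (Fin m) F) : Prop :=
  ∀ x ∈ Λ, g.mulVecLin x ∈ Λ

/-- The `O_F`-linear endomorphism of `Λ` induced by a stabilizing matrix. -/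
def latMap (Λ : Submodule ↥(OF F) (Fin m → F)) (g : Matrix (Fin m) (Fin m) F)
    (h : MStab Λ g) : ↥Λ →ₗ[↥(OF F)] ↥Λ :=
  LinearMap.restrict ((g.mulVecLin).restrictScalars ↥(OF F)) h

/-- The reduction `Λ ⊗_{O_F} k = Λ / 𝔪·Λ` of a lattice modulo the maximal ideal. -/
def Red (Λ : Submodule ↥(OF F) (Fin m → F)) : Type :=
  ↥Λ ⧸ ((maximalIdeal ↥(OF F)) • (⊤ : Submodule ↥(OF F) ↥Λ))

instance (Λ : Submodule ↥(OF F) (Fin m → F)) : AddCommGroup (Red Λ) := by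
  unfold Red; infer_instance

instance (Λ : Submodule ↥(OF F) (Fin m → F)) : Module ↥(OF F) (Red Λ) := by
  unfold Red; infer_instance

/-- The endomorphism of the reduction `Λ/𝔪Λ` induced by a stabilizing matrix. -/
def redMap (Λ : Submodule ↥(OF F) (Fin m → F)) (g : Matrix (Fin m) (Fin m) F)
    (h : MStab Λ g) : Red Λ →ₗ[↥(OF F)] Red Λ :=
  Submodule.mapQ _ _ (latMap Λ g h)
    (Submodule.smul_le.2 fun r hr x _ => Submodule.mem_comap.2 (by
      rw [LinearMap.map_smul]
      exact Submodule.smul_mem_smul hr Submodule.mem_top))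

/-- The space of linear maps intertwining two families of endomorphisms, given as a set
`P` of compatible pairs. -/
def intertwiners (F M N : Type) [Field F] [AddCommGroup M] [Module F M]
    [AddCommGroup N] [Module F N] (P : Set (Module.End F M × Module.End F N)) :
    Submodule F (M →ₗ[F] N) where
  carrier := {f | ∀ p ∈ P, p.2 ∘ₗ f = f ∘ₗ p.1}
  zero_mem' := by intro p _; simp
  add_mem' := by
    intro f g hf hg p hp
    simp [LinearMap.comp_add, LinearMap.add_comp, hf p hp, hg p hp]
  smul_mem' := by
    intro c f hf p hp
    simp [LinearMap.comp_smul, LinearMap.smul_comp, hf p hp]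

/-- `dim_F` of the space of intertwiners. -/
def intertwinerDim (F M N : Type) [Field F] [AddCommGroup M] [Module F M]
    [AddCommGroup N] [Module F N] (P : Set (Module.End F M × Module.End F N)) : ℕ :=
  Module.finrank F ↥(intertwiners F M N P)

/-- The pairs of restricted actions of `g ∈ Γ` on two `Γ`-stable subspaces `W`, `W'`. -/
def actionPairs (Γ : Subgroup (GL (Fin m) F)) (W W' : Submodule F (Fin m → F)) :
    Set (Module.End F ↥W × Module.End F ↥W') :=
  {p | ∃ g ∈ Γ, ∃ (h : ∀ x ∈ W, ((g : Matrix (Fin m) (Fin m) F)).mulVecLin x ∈ W)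
      (h' : ∀ x ∈ W', ((g : Matrix (Fin m) (Fin m) F)).mulVecLin x ∈ W'),
    p = (LinearMap.restrict ((g : Matrix (Fin m) (Fin m) F)).mulVecLin h,
         LinearMap.restrict ((g : Matrix (Fin m) (Fin m) F)).mulVecLin h')}

/-- `Hom_Γ(Λ/𝔪Λ, Λ'/𝔪Λ')`: `O_F`-linear maps between the reductions commuting with the
induced action of `Γ`. -/
def RedHom (Γ : Subgroup (GL (Fin m) F)) (Λ Λ' : Submodule ↥(OF F) (Fin m → F))
    (hst : ∀ g ∈ Γ, MStab Λ (g : Matrix (Fin m) (Fin m) F))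
    (hst' : ∀ g ∈ Γ, MStab Λ' (g : Matrix (Fin m) (Fin m) F)) : Type :=
  {f : Red Λ →ₗ[↥(OF F)] Red Λ' //
    ∀ g (hg : g ∈ Γ), redMap Λ' _ (hst' g hg) ∘ₗ f = f ∘ₗ redMap Λ _ (hst g hg)}

/-- If an `R`-lattice `N` in a `K`-vector space `H` admits a map to a finite type `X` that separates
points modulo the maximal ideal, then `|k| ^ dim H ≤ |X|`. -/
theorem card_residueField_pow_finrank_le {R K V X : Type*} [CommRing R] [IsDomain R]
    [IsPrincipalIdealRing R] [IsLocalRing R] [Field K] [Algebra R K] [IsFractionRing R K]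
    [AddCommGroup V] [Module K V] [Module R V] [IsScalarTower R K V] [Finite X]
    (H : Submodule K V) (N : Submodule R V) [Module.Finite R N]
    (hspan : ∀ h ∈ H, ∃ c : R, c ≠ 0 ∧ c • h ∈ N)
    (φ : N → X) (hφ : ∀ a b, φ a = φ b → a - b ∈ maximalIdeal R • (⊤ : Submodule R N)) :
    Nat.card (ResidueField R) ^ Module.finrank K H ≤ Nat.card X := by
  have : Module.IsTorsionFree R V := Module.IsTorsionFree.trans_faithfulSMul R K V
  obtain ⟨n, b⟩ := Module.basisOfFiniteTypeTorsionFree' (R := R) (M := N)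
  have hsp : H ≤ Submodule.span K (Set.range fun i => ((b i : N) : V)) := by
    intro h hh
    obtain ⟨c, hc, hcN⟩ := hspan h hh
    have hcK : algebraMap R K c ≠ 0 := by
      simpa using hc
    have key : c • h ∈ Submodule.span K (Set.range fun i => ((b i : N) : V)) := by
      have := congrArg (N.subtype) (b.sum_repr ⟨c • h, hcN⟩)
      simp only [map_sum, map_smul, Submodule.subtype_apply] at this
      rw [← this]
      refine Submodule.sum_mem _ fun i _ => ?_
      rw [← algebraMap_smul K]
      exact Submodule.smul_mem _ _ (Submodule.subset_span ⟨i, rfl⟩)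
    rw [← algebraMap_smul K] at key
    exact (Submodule.smul_mem_iff _ hcK).1 key
  have hdim : Module.finrank K H ≤ n := by
    have := Module.Finite.span_of_finite K (Set.finite_range fun i => ((b i : N) : V))
    exact (Submodule.finrank_mono hsp).trans ((finrank_range_le_card _).trans (by simp))
  let g : (Fin n → ResidueField R) → X := fun c =>
    φ (b.equivFun.symm fun i => (residue_surjective (c i)).choose)
  have hg : Function.Injective g := by
    intro c c' hcc
    have h := hφ _ _ hcc
    rw [← map_sub] at h
    have hrepr := fun i => Submodule.smul_induction_on
      (p := fun x => b.equivFun x i ∈ maximalIdeal R)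
      h (fun r hr x _ => by
        rw [map_smul]
        exact Ideal.mul_mem_right _ _ hr) (fun x y hx hy => by
        rw [map_add]
        exact add_mem hx hy)
    funext i
    have h1 := hrepr i
    rw [LinearEquiv.apply_symm_apply, Pi.sub_apply, ← residue_eq_zero_iff, map_sub, sub_eq_zero,
      (residue_surjective (c i)).choose_spec, (residue_surjective (c' i)).choose_spec] at h1
    exact h1
  have hcard := Nat.card_le_card_of_injective g hg
  rw [Nat.card_fun, Nat.card_fin] at hcard
  rcases Nat.eq_zero_or_pos (Nat.card (ResidueField R)) with h0 | hpos
  · rcases Nat.eq_zero_or_pos (Module.finrank K H) with hd | hd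
    · have := Finite.card_pos_iff.2 (⟨φ 0⟩ : Nonempty X)
      rw [hd, pow_zero]
      exact this
    · simp [h0, hd.ne']
  · exact (Nat.pow_le_pow_right hpos hdim).trans hcard

/-- A vector in the `K`-span of an `R`-submodule has a denominator in `R`. -/
theorem exists_smul_mem_of_mem_span {R K V : Type*} [CommRing R] [IsDomain R] [Field K]
    [Algebra R K] [IsFractionRing R K] [AddCommGroup V] [Module K V] [Module R V]
    [IsScalarTower R K V] (L : Submodule R V) {x : V}
    (hx : x ∈ Submodule.span K (L : Set V)) : ∃ c : R, c ≠ 0 ∧ c • x ∈ L := by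
  induction hx using Submodule.span_induction with
  | mem x hx => exact ⟨1, one_ne_zero, by simpa using hx⟩
  | zero => exact ⟨1, one_ne_zero, by simp⟩
  | add x y _ _ hx hy =>
    obtain ⟨c, hc, hcx⟩ := hx
    obtain ⟨d, hd, hdy⟩ := hy
    refine ⟨c * d, mul_ne_zero hc hd, ?_⟩
    rw [smul_add]
    refine add_mem ?_ ?_
    · rw [mul_comm, mul_smul]
      exact L.smul_mem _ hcx
    · rw [mul_smul]
      exact L.smul_mem _ hdy
  | smul a x _ hx =>
    obtain ⟨c, hc, hcx⟩ := hx
    obtain ⟨p, q, hq, rfl⟩ := IsFractionRing.div_surjective (A := R) a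
    refine ⟨c * q, mul_ne_zero hc (nonZeroDivisors.ne_zero hq), ?_⟩
    have hq' : algebraMap R K q ≠ 0 := by simpa using nonZeroDivisors.ne_zero hq
    have : (c * q) • ((algebraMap R K p / algebraMap R K q) • x) = p • c • x := by
      rw [← algebraMap_smul K (c * q), ← algebraMap_smul K p, ← algebraMap_smul K c, smul_smul,
        smul_smul, map_mul]
      congr 1
      field_simp
    rw [this]
    exact L.smul_mem _ hcx

/-- The images of a finitely generated module in the `K`-span of an `R`-submodule have a common
denominator. -/
theorem exists_smul_map_le_of_fg {R K V V' : Type*} [CommRing R] [IsDomain R] [Field K]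
    [Algebra R K] [IsFractionRing R K] [AddCommGroup V] [Module R V]
    [AddCommGroup V'] [Module K V'] [Module R V']
    [IsScalarTower R K V'] {L : Submodule R V} (hL : L.FG) (L' : Submodule R V')
    (f : L →ₗ[R] V') (hf : ∀ x, f x ∈ Submodule.span K (L' : Set V')) :
    ∃ c : R, c ≠ 0 ∧ ∀ x, c • f x ∈ L' := by
  obtain ⟨S, hS⟩ := (Submodule.fg_top L).2 hL
  choose c hc hcL using fun x => exists_smul_mem_of_mem_span L' (hf x)
  refine ⟨∏ x ∈ S, c x, Finset.prod_ne_zero_iff.2 fun x _ => hc x, fun x => ?_⟩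
  have hx : x ∈ Submodule.span R (S : Set L) := hS ▸ Submodule.mem_top
  induction hx using Submodule.span_induction with
  | mem x hx =>
    classical
    rw [← Finset.prod_erase_mul S c hx, mul_smul]
    exact L'.smul_mem _ (hcL x)
  | zero => simp
  | add x y _ _ hx hy =>
    rw [map_add, smul_add]
    exact add_mem hx hy
  | smul a x _ hx =>
    rw [map_smul, smul_comm]
    exact L'.smul_mem _ hx

/-- The lattice of those `h ∈ H` that map `L` into `L'`. -/
def latticeHom {R K V V' : Type*} [CommRing R] [Field K] [Algebra R K]
    [AddCommGroup V] [Module K V] [Module R V]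
    [AddCommGroup V'] [Module K V'] [Module R V'] [IsScalarTower R K V']
    (W : Submodule K V) (W' : Submodule K V') (L : Submodule R V) (L' : Submodule R V')
    (H : Submodule K (W →ₗ[K] W')) : Submodule R (W →ₗ[K] W') where
  carrier := {f | f ∈ H ∧ ∀ x : W, (x : V) ∈ L → (f x : V') ∈ L'}
  zero_mem' := ⟨zero_mem _, fun _ _ => L'.zero_mem⟩
  add_mem' hf hg := ⟨add_mem hf.1 hg.1, fun x hx => L'.add_mem (hf.2 x hx) (hg.2 x hx)⟩
  smul_mem' c _ hf := ⟨Submodule.smul_of_tower_mem _ c hf.1, fun x hx => L'.smul_mem c (hf.2 x hx)⟩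

section LatticeHom

variable {R K V V' : Type*} [CommRing R] [Field K] [Algebra R K]
  [AddCommGroup V] [Module K V] [Module R V] [IsScalarTower R K V]
  [AddCommGroup V'] [Module K V'] [Module R V'] [IsScalarTower R K V']
  {W : Submodule K V} {W' : Submodule K V'} {L : Submodule R V} {L' : Submodule R V'}
  {H : Submodule K (W →ₗ[K] W')}

/-- Restriction of linear maps preserving lattices to the lattices. -/
def latticeRestrict (hLW : (L : Set V) ⊆ W) : latticeHom W W' L L' H →ₗ[R] L →ₗ[R] L' where
  toFun f :=
    { toFun := fun x => ⟨f.1 ⟨x, hLW x.2⟩, f.2.2 _ x.2⟩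
      map_add' := fun x y => Subtype.ext
        (congrArg (fun z : W' => (z : V')) (map_add f.1 ⟨x, hLW x.2⟩ ⟨y, hLW y.2⟩))
      map_smul' := fun c x => Subtype.ext (congrArg (fun z : W' => (z : V'))
        (LinearMap.map_smul_of_tower f.1 c ⟨x, hLW x.2⟩)) }
  map_add' _ _ := rfl
  map_smul' _ _ := rfl

variable [IsDomain R] [IsFractionRing R K]

theorem latticeRestrict_injective (hLW : (L : Set V) ⊆ W)
    (hspan : Submodule.span K (L : Set V) = W) :
    Function.Injective (latticeRestrict (L' := L') (H := H) hLW) := by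
  intro f f' h
  refine Subtype.ext (LinearMap.ext fun x => ?_)
  obtain ⟨c, hc, hcx⟩ := exists_smul_mem_of_mem_span (K := K) L (x := (x : V))
    (by rw [hspan]; exact x.2)
  have h2 := LinearMap.congr_fun h ⟨c • (x : V), hcx⟩
  have h1 : f.1 (c • x) = f'.1 (c • x) :=
    Subtype.ext (congrArg (fun y : L' => (y : V')) h2)
  rw [← algebraMap_smul K c x, map_smul, map_smul] at h1
  exact smul_right_injective _ (by simpa using hc : algebraMap R K c ≠ 0) h1

theorem exists_smul_mem_latticeHom (hLW : (L : Set V) ⊆ W) (hL : L.FG)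
    (hspan' : Submodule.span K (L' : Set V') = W') {h : W →ₗ[K] W'} (hh : h ∈ H) :
    ∃ c : R, c ≠ 0 ∧ c • h ∈ latticeHom W W' L L' H := by
  let j : L →ₗ[R] W := LinearMap.codRestrict (W.restrictScalars R) L.subtype fun x => hLW x.2
  obtain ⟨c, hc, hcL⟩ := exists_smul_map_le_of_fg (K := K) hL L'
    ((W'.subtype.restrictScalars R) ∘ₗ (h.restrictScalars R) ∘ₗ j)
    (fun x => by rw [hspan']; exact (h (j x)).2)
  exact ⟨c, hc, Submodule.smul_of_tower_mem _ c hh, fun x hx => hcL ⟨x, hx⟩⟩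

theorem mem_maximalIdeal_smul_latticeHom [IsDiscreteValuationRing R]
    (hLW : (L : Set V) ⊆ W) (f : latticeHom W W' L L' H)
    (hf : ∀ x, latticeRestrict hLW f x ∈ maximalIdeal R • (⊤ : Submodule R L')) :
    f ∈ maximalIdeal R • (⊤ : Submodule R (latticeHom W W' L L' H)) := by
  obtain ⟨π, hπ⟩ := IsDiscreteValuationRing.exists_irreducible R
  have hπ0 : algebraMap R K π ≠ 0 := by simpa using hπ.ne_zero
  have hmem : (algebraMap R K π)⁻¹ • f.1 ∈ latticeHom W W' L L' H := by
    refine ⟨Submodule.smul_mem _ _ f.2.1, fun x hx => ?_⟩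
    have hfx := hf ⟨x, hx⟩
    rw [hπ.maximalIdeal_eq, Submodule.ideal_span_singleton_smul] at hfx
    obtain ⟨y, -, hy⟩ := (Submodule.mem_smul_pointwise_iff_exists _ _ _).1 hfx
    have hy' : π • (y : V') = (f.1 x : V') := congrArg (fun z : L' => (z : V')) hy
    rw [LinearMap.smul_apply, Submodule.coe_smul, ← hy', ← algebraMap_smul K π,
      inv_smul_smul₀ hπ0]
    exact y.2
  have hfπ : f = π • ⟨(algebraMap R K π)⁻¹ • f.1, hmem⟩ := by
    refine Subtype.ext ?_
    rw [Submodule.coe_smul, ← algebraMap_smul K π, smul_inv_smul₀ hπ0]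
  rw [hfπ]
  refine Submodule.smul_mem_smul ?_ Submodule.mem_top
  rw [hπ.maximalIdeal_eq]
  exact Ideal.mem_span_singleton_self π

/-- If the maps in `H` preserving the lattices are separated, modulo the maximal ideal, by a map to
a finite type `X`, then `|k| ^ dim H ≤ |X|`. -/
theorem card_residueField_pow_finrank_le_of_latticeHom [IsDiscreteValuationRing R]
    {X : Type*} [Finite X] (hLW : (L : Set V) ⊆ W) (hL : L.FG) (hL' : L'.FG)
    (hspan : Submodule.span K (L : Set V) = W) (hspan' : Submodule.span K (L' : Set V') = W')
    (φ : latticeHom W W' L L' H → X)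
    (hφ : ∀ a b, φ a = φ b → ∀ x, latticeRestrict hLW a x - latticeRestrict hLW b x ∈
      maximalIdeal R • (⊤ : Submodule R L')) :
    Nat.card (ResidueField R) ^ Module.finrank K H ≤ Nat.card X := by
  have := Module.Finite.iff_fg.2 hL
  have := Module.Finite.iff_fg.2 hL'
  have : Module.IsTorsionFree R V := Module.IsTorsionFree.trans_faithfulSMul R K V
  have : Module.IsTorsionFree R V' := Module.IsTorsionFree.trans_faithfulSMul R K V'
  have : Module.Finite R (latticeHom W W' L L' H) :=
    Module.Finite.of_injective _ (latticeRestrict_injective hLW hspan)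
  refine card_residueField_pow_finrank_le H (latticeHom W W' L L' H)
    (fun h hh => exists_smul_mem_latticeHom hLW hL hspan' hh) φ fun a b hab =>
      mem_maximalIdeal_smul_latticeHom hLW _ (hφ a b hab)

end LatticeHom

theorem isDiscreteValuationRing_OF (hdisc : Function.Surjective (Valued.v : F → Zm0)) :
    IsDiscreteValuationRing ↥(OF F) := by
  have : IsCyclic (Zm0)ˣ :=
    isCyclic_of_surjective WithZero.unitsWithZeroEquiv.symm
      WithZero.unitsWithZeroEquiv.symm.surjective
  have : Nontrivial (MonoidWithZeroHom.valueGroup (.ofClass (Valued.v : Valuation F Zm0))) := by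
    obtain ⟨x, hx⟩ := hdisc (WithZero.exp (-1))
    refine (Subgroup.nontrivial_iff_exists_ne_one _).2
      ⟨Units.mk0 (WithZero.exp (-1)) (by simp), ?_, ?_⟩
    · exact MonoidWithZeroHom.mem_valueGroup _ ⟨x, hx⟩
    · intro h
      have := congrArg Units.val h
      revert this
      decide
  exact Valuation.valuationSubring_isDiscreteValuationRing (Valued.v : Valuation F Zm0)

theorem finite_red [Finite (ResidueField ↥(OF F))] {L : Submodule ↥(OF F) (Fin m → F)}
    (hL : L.FG) : Finite (Red L) := by
  have : Module.Finite ↥(OF F) L := Module.Finite.iff_fg.2 hL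
  have : Finite (↥(OF F) ⧸ maximalIdeal ↥(OF F)) :=
    inferInstanceAs (Finite (ResidueField ↥(OF F)))
  change Finite (↥L ⧸ (maximalIdeal ↥(OF F) • (⊤ : Submodule ↥(OF F) L)))
  exact Module.finite_of_finite (↥(OF F) ⧸ maximalIdeal ↥(OF F))

/-- The `O_F`-linear map between the reductions of two lattices induced by a map of lattices. -/
def redHomMap {L L' : Submodule ↥(OF F) (Fin m → F)} (f : L →ₗ[↥(OF F)] L') :
    Red L →ₗ[↥(OF F)] Red L' :=
  Submodule.mapQ _ _ f
    (Submodule.smul_le.2 fun r hr x _ => Submodule.mem_comap.2 (by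
      rw [LinearMap.map_smul]
      exact Submodule.smul_mem_smul hr Submodule.mem_top))

theorem redMap_comp_redHomMap {L L' : Submodule ↥(OF F) (Fin m → F)} (f : L →ₗ[↥(OF F)] L')
    {g : Matrix (Fin m) (Fin m) F} (h : MStab L g) (h' : MStab L' g)
    (hf : latMap L' g h' ∘ₗ f = f ∘ₗ latMap L g h) :
    redMap L' g h' ∘ₗ redHomMap f = redHomMap f ∘ₗ redMap L g h := by
  refine Submodule.linearMap_qext _ (LinearMap.ext fun x => ?_)
  exact congrArg (Submodule.Quotient.mk (p := maximalIdeal ↥(OF F) • (⊤ : Submodule ↥(OF F) L')))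
    (LinearMap.congr_fun hf x)

theorem sub_mem_of_redHomMap_eq {L L' : Submodule ↥(OF F) (Fin m → F)}
    {f f' : L →ₗ[↥(OF F)] L'} (h : redHomMap f = redHomMap f') (x : L) :
    f x - f' x ∈ maximalIdeal ↥(OF F) • (⊤ : Submodule ↥(OF F) L') :=
  (Submodule.Quotient.eq _).1 (LinearMap.congr_fun h (Submodule.Quotient.mk x))

theorem latMap_comp_latticeRestrict {Γ : Subgroup (GL (Fin m) F)}
    {W W' : Submodule F (Fin m → F)} {L L' : Submodule ↥(OF F) (Fin m → F)}
    (hLW : (L : Set (Fin m → F)) ⊆ W)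
    (f : latticeHom W W' L L' (intertwiners F W W' (actionPairs Γ W W')))
    {g : GL (Fin m) F} (hg : g ∈ Γ)
    (hW : ∀ x ∈ W, (g : Matrix (Fin m) (Fin m) F).mulVecLin x ∈ W)
    (hW' : ∀ x ∈ W', (g : Matrix (Fin m) (Fin m) F).mulVecLin x ∈ W')
    (h : MStab L (g : Matrix (Fin m) (Fin m) F)) (h' : MStab L' (g : Matrix (Fin m) (Fin m) F)) :
    latMap L' _ h' ∘ₗ latticeRestrict hLW f = latticeRestrict hLW f ∘ₗ latMap L _ h := by
  refine LinearMap.ext fun x => Subtype.ext ?_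
  have key := LinearMap.congr_fun (f.2.1 _ ⟨g, hg, hW, hW', rfl⟩) ⟨x, hLW x.2⟩
  exact congrArg (fun z : W' => (z : Fin m → F)) key

/-- Let `F` be a complete discretely valued field of characteristic zero
with valuation ring `O_F` and residue field `k` (finite here, so that the dimension
inequality over `k` can be stated via cardinalities), `Γ` a compact subgroup of
`GL(V)`, `V = F^m`, and `W, W'` `Γ`-subrepresentations of `V` with `Γ`-stable lattices
`Λ ⊂ W`, `Λ' ⊂ W'`.  Then
`dim_F Hom_Γ(W, W') ≤ dim_k Hom_Γ(Λ ⊗ k, Λ' ⊗ k)`, expressed as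
`|k| ^ dim_F Hom_Γ(W, W') ≤ |Hom_Γ(Λ/𝔪Λ, Λ'/𝔪Λ')|`. -/
theorem stmt_13 (F : Type) [Field F] [Valued F Zm0] [CompleteSpace F] [CharZero F]
    (hdisc : Function.Surjective (Valued.v : F → Zm0))
    [Finite (ResidueField ↥(OF F))]
    (m : ℕ) (Γ : Subgroup (GL (Fin m) F))
    (hcpt : IsCompact ((Γ : Set (GL (Fin m) F))))
    (W W' : Submodule F (Fin m → F))
    (hW : ∀ g ∈ Γ, ∀ x ∈ W, ((g : Matrix (Fin m) (Fin m) F)).mulVecLin x ∈ W)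
    (hW' : ∀ g ∈ Γ, ∀ x ∈ W', ((g : Matrix (Fin m) (Fin m) F)).mulVecLin x ∈ W')
    (Λ Λ' : Submodule ↥(OF F) (Fin m → F))
    (hΛW : (Λ : Set (Fin m → F)) ⊆ (W : Set (Fin m → F))) (hΛFG : Λ.FG)
    (hΛspan : Submodule.span F (Λ : Set (Fin m → F)) = W)
    (hΛ'W' : (Λ' : Set (Fin m → F)) ⊆ (W' : Set (Fin m → F))) (hΛ'FG : Λ'.FG)
    (hΛ'span : Submodule.span F (Λ' : Set (Fin m → F)) = W')
    (hst : ∀ g ∈ Γ, MStab Λ (g : Matrix (Fin m) (Fin m) F))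
    (hst' : ∀ g ∈ Γ, MStab Λ' (g : Matrix (Fin m) (Fin m) F)) :
    Nat.card (ResidueField ↥(OF F)) ^
        intertwinerDim F ↥W ↥W' (actionPairs Γ W W') ≤
      Nat.card (RedHom Γ Λ Λ' hst hst') := by
  have := isDiscreteValuationRing_OF hdisc
  have : Finite (RedHom Γ Λ Λ' hst hst') := by
    have := finite_red hΛFG
    have := finite_red hΛ'FG
    have : Finite (Red Λ →ₗ[↥(OF F)] Red Λ') := DFunLike.finite _
    exact Subtype.finite
  exact card_residueField_pow_finrank_le_of_latticeHom hΛW hΛFG hΛ'FG hΛspan hΛ'span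
    (fun f => (⟨redHomMap (latticeRestrict hΛW f), fun g hg => redMap_comp_redHomMap _ _ _
      (latMap_comp_latticeRestrict hΛW f hg (hW g hg) (hW' g hg) (hst g hg) (hst' g hg))⟩ :
        RedHom Γ Λ Λ' hst hst'))
    fun a b hab x => sub_mem_of_redHomMap_eq (congrArg Subtype.val hab) x

end
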